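/- Suppose a_1 = a_2 < a_3 = a_4 < … (pairs of equal values, with a final unpaired value if n is even). Then the collection consisting of all F_B (with b_{2i−1} = b_{2i}) together with the linear functions M_{2i−1,2i}, 1 ≤ i ≤ ⌊(n+1)/2⌋, is Poisson commutative on T*S^n, and contains n functionally independent functions; in particular the degenerate Neumann system with potential ∑ a_i (X^i)^2 on S^n is Liouville integrable. -/

import Mathlib

open scoped BigOperators

/-- Ambient coordinates on `T*Sⁿ ⊂ ℝ^{n+1} × ℝ^{n+1}`: pairs `(x, p)`. -/
abbrev Phase (N : ℕ) := (Fin N → ℝ) × (Fin N → ℝ)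

/-- The canonical Poisson bracket in the ambient coordinates `(x, p)`:
`{F,G} = ∑ₖ (∂F/∂pₖ ∂G/∂xₖ - ∂F/∂xₖ ∂G/∂pₖ)`. -/
noncomputable def pb {N : ℕ} (F G : Phase N → ℝ) (z : Phase N) : ℝ :=
  ∑ k, (fderiv ℝ F z ((0 : Fin N → ℝ), Pi.single k 1)
          * fderiv ℝ G z (Pi.single k 1, (0 : Fin N → ℝ))
      - fderiv ℝ F z (Pi.single k 1, (0 : Fin N → ℝ))
          * fderiv ℝ G z ((0 : Fin N → ℝ), Pi.single k 1))

/-- `T*Sⁿ` realized as the constraint set `{|x| = 1, ⟨x,p⟩ = 0}`. -/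
def TS (N : ℕ) : Set (Phase N) := {z | (∑ k, (z.1 k)^2 = 1) ∧ (∑ k, z.1 k * z.2 k = 0)}

/-- Momentum function `M_{ij}` of the rotation `Xⁱ ∂_{Xʲ} - Xʲ ∂_{Xⁱ}`. -/
def Mf {N : ℕ} (i j : Fin N) (z : Phase N) : ℝ := z.1 i * z.2 j - z.1 j * z.2 i

/-- The integral of the degenerate Neumann system:
`F_B = (1/2) ∑_{i<j, aᵢ≠aⱼ} ((bᵢ-bⱼ)/(aᵢ-aⱼ)) M_{ij}² + ∑ᵢ bᵢ (Xⁱ)²`. -/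
noncomputable def FBdeg {N : ℕ} (a B : Fin N → ℝ) (z : Phase N) : ℝ :=
  (1/2) * ∑ i, ∑ j ∈ Finset.Ioi i,
      (if a i = a j then 0 else (B i - B j)/(a i - a j)) * (Mf i j z)^2
    + ∑ i, B i * (z.1 i)^2

/-- Index of `X^{2i-1}` (0-based: `2i`). -/
def pIdx (n : ℕ) (i : Fin ((n+1)/2)) : Fin (n+1) := ⟨2 * i.val, by have := i.isLt; omega⟩

/-- Index of `X^{2i}` (0-based: `2i+1`). -/
def qIdx (n : ℕ) (i : Fin ((n+1)/2)) : Fin (n+1) := ⟨2 * i.val + 1, by have := i.isLt; omega⟩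

/-- A vector `w` is tangent to the constraint set `T*Sⁿ = {|x|²=1, ⟨x,p⟩=0}` at `z`. -/
def TangentTS {N : ℕ} (z w : Phase N) : Prop :=
  (∑ k, z.1 k * w.1 k = 0) ∧ (∑ k, (w.1 k * z.2 k + z.1 k * w.2 k) = 0)

/-- The differentials of the functions `F k` (restricted to the tangent space of
`T*Sⁿ` at `z`) are linearly independent. -/
def IndepAt {N m : ℕ} (F : Fin m → (Phase N → ℝ)) (z : Phase N) : Prop :=
  ∀ c : Fin m → ℝ,
    (∀ w : Phase N, TangentTS z w → ∑ k, c k * fderiv ℝ (F k) z w = 0) → c = 0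

/-- `B` takes equal values on each pair `{2i-1, 2i}` (0-based: `k/2 = l/2`). -/
def Paired (n : ℕ) (B : Fin (n+1) → ℝ) : Prop :=
  ∀ k l : Fin (n+1), (k : ℕ)/2 = (l : ℕ)/2 → B k = B l


/-- coefficients -/
noncomputable def cf {N : ℕ} (a B : Fin N → ℝ) (i j : Fin N) : ℝ :=
  if a i = a j then 0 else (B i - B j)/(a i - a j)

lemma cf_symm {N : ℕ} (a B : Fin N → ℝ) (i j : Fin N) : cf a B i j = cf a B j i := by
  unfold cf
  by_cases h : a i = a j
  · simp [h]
  · rw [if_neg h, if_neg (Ne.symm h), ← neg_sub (B j), ← neg_sub (a j), neg_div_neg_eq]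

lemma cf_mul {N : ℕ} (a B : Fin N → ℝ) (h : ∀ i j, a i = a j → B i = B j) (i j : Fin N) :
    cf a B i j * (a i - a j) = B i - B j := by
  unfold cf
  by_cases e : a i = a j
  · simp [e, h i j e]
  · rw [if_neg e, div_mul_cancel₀ _ (sub_ne_zero.2 e)]

lemma Mf_symm {N : ℕ} (i j : Fin N) (z : Phase N) : Mf i j z = - Mf j i z := by
  unfold Mf; ring

lemma sum_Ioi_half {N : ℕ} (f : Fin N → Fin N → ℝ) (hs : ∀ i j, f i j = f j i)
    (hd : ∀ i, f i i = 0) :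
    ∑ i, ∑ j ∈ Finset.Ioi i, f i j = (1/2) * ∑ i, ∑ j, f i j := by
  have h := Finset.sum_sum_Ioi_add_eq_sum_sum_off_diag f
  have h2 : ∀ i, ∑ j ∈ ({i} : Finset (Fin N))ᶜ, f j i = ∑ j, f i j := by
    intro i
    rw [← Finset.sum_compl_add_sum {i}]
    simp [hd, hs i]
  simp only [h2] at h
  rw [← h]
  simp only [fun i j => hs j i, Finset.mul_sum]
  refine Finset.sum_congr rfl fun i _ => Finset.sum_congr rfl fun j _ => ?_
  ring_nf
  try rw [hs j i]
  try ring

lemma FBdeg_eq {N : ℕ} (a B : Fin N → ℝ) (z : Phase N) :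
    FBdeg a B z = (1/4) * ∑ i, ∑ j, cf a B i j * (Mf i j z)^2 + ∑ i, B i * (z.1 i)^2 := by
  have := sum_Ioi_half (fun i j => cf a B i j * (Mf i j z)^2)
    (fun i j => by simp only [cf_symm a B i j, Mf_symm i j]; ring) (fun i => by simp [Mf])
  unfold FBdeg
  simp only [cf] at this ⊢
  rw [this]; ring

/-- derivative of Mf -/
noncomputable def DM {N : ℕ} (i j : Fin N) (z : Phase N) : Phase N →L[ℝ] ℝ :=
  let X := fun k => (ContinuousLinearMap.proj k).comp (ContinuousLinearMap.fst ℝ (Fin N → ℝ) (Fin N → ℝ))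
  let P := fun k => (ContinuousLinearMap.proj k).comp (ContinuousLinearMap.snd ℝ (Fin N → ℝ) (Fin N → ℝ))
  (z.1 i • P j + z.2 j • X i) - (z.1 j • P i + z.2 i • X j)

lemma hasX {N : ℕ} (k : Fin N) (z : Phase N) : HasFDerivAt (fun z : Phase N => z.1 k)
   ((ContinuousLinearMap.proj k).comp (ContinuousLinearMap.fst ℝ (Fin N → ℝ) (Fin N → ℝ))) z :=
  ((ContinuousLinearMap.proj (R := ℝ) (φ := fun _ : Fin N => ℝ) k).comp (ContinuousLinearMap.fst ℝ (Fin N → ℝ) (Fin N → ℝ))).hasFDerivAt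

lemma hasP {N : ℕ} (k : Fin N) (z : Phase N) : HasFDerivAt (fun z : Phase N => z.2 k)
   ((ContinuousLinearMap.proj k).comp (ContinuousLinearMap.snd ℝ (Fin N → ℝ) (Fin N → ℝ))) z :=
  ((ContinuousLinearMap.proj (R := ℝ) (φ := fun _ : Fin N => ℝ) k).comp (ContinuousLinearMap.snd ℝ (Fin N → ℝ) (Fin N → ℝ))).hasFDerivAt

lemma hasM {N : ℕ} (i j : Fin N) (z : Phase N) : HasFDerivAt (Mf i j) (DM i j z) z :=
  ((hasX i z).mul (hasP j z)).sub ((hasX j z).mul (hasP i z))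

lemma DM_apply {N : ℕ} (i j : Fin N) (z w : Phase N) : DM i j z w =
    (z.1 i * w.2 j + z.2 j * w.1 i) - (z.1 j * w.2 i + z.2 i * w.1 j) := by
  simp [DM]

lemma fderiv_M {N : ℕ} (i j : Fin N) (z w : Phase N) : fderiv ℝ (Mf i j) z w =
    (z.1 i * w.2 j + z.2 j * w.1 i) - (z.1 j * w.2 i + z.2 i * w.1 j) := by
  rw [(hasM i j z).fderiv, DM_apply]

/-- p-gradient -/
noncomputable def gp {N : ℕ} (a B : Fin N → ℝ) (z : Phase N) (k : Fin N) : ℝ :=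
  ∑ i, cf a B i k * Mf i k z * z.1 i
/-- x-gradient -/
noncomputable def gx {N : ℕ} (a B : Fin N → ℝ) (z : Phase N) (k : Fin N) : ℝ :=
  - (∑ i, cf a B i k * Mf i k z * z.2 i) + 2 * B k * z.1 k

lemma fderiv_FB {N : ℕ} (a B : Fin N → ℝ) (z w : Phase N) : fderiv ℝ (FBdeg a B) z w =
    ∑ k, gp a B z k * w.2 k + ∑ k, gx a B z k * w.1 k := by
  have h : HasFDerivAt (FBdeg a B) ((1/4 : ℝ) • ∑ i, ∑ j, cf a B i j • ((2 * Mf i j z) • DM i j z)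
      + ∑ i, B i • ((2 * z.1 i) • ((ContinuousLinearMap.proj i).comp (ContinuousLinearMap.fst ℝ (Fin N → ℝ) (Fin N → ℝ))))) z := by
    have e : FBdeg a B = fun z => (1/4) * ∑ i, ∑ j, cf a B i j * (Mf i j z)^2 + ∑ i, B i * (z.1 i)^2 :=
      funext (FBdeg_eq a B)
    rw [e]
    refine HasFDerivAt.add (HasFDerivAt.const_mul (HasFDerivAt.fun_sum fun i _ => HasFDerivAt.fun_sum fun j _ =>
       HasFDerivAt.const_mul ?_ _) _) (HasFDerivAt.fun_sum fun i _ => HasFDerivAt.const_mul ?_ _)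
    · simpa using (hasM i j z).pow 2
    · simpa using (hasX i z).pow 2
  rw [h.fderiv]
  have e1 : ∑ i, ∑ j, cf a B i j * (2 * Mf i j z * DM i j z w) =
     4 * ∑ i, ∑ j, (cf a B j i * Mf j i z * z.1 j * w.2 i - cf a B j i * Mf j i z * z.2 j * w.1 i) := by
    have : ∑ i, ∑ j, cf a B i j * (2 * Mf i j z * DM i j z w) =
      ∑ i, ∑ j, 2 * (cf a B j i * Mf j i z * z.1 j * w.2 i - cf a B j i * Mf j i z * z.2 j * w.1 i)
      + ∑ i, ∑ j, 2 * (cf a B i j * Mf i j z * z.1 i * w.2 j - cf a B i j * Mf i j z * z.2 i * w.1 j) := by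
      rw [← Finset.sum_add_distrib]
      refine Finset.sum_congr rfl fun i _ => ?_
      rw [← Finset.sum_add_distrib]
      refine Finset.sum_congr rfl fun j _ => ?_
      rw [DM_apply, cf_symm a B j i, Mf_symm j i]; ring
    rw [this, Finset.sum_comm (f := fun i j => 2 * (cf a B i j * Mf i j z * z.1 i * w.2 j - cf a B i j * Mf i j z * z.2 i * w.1 j))]
    simp only [← Finset.mul_sum]; ring
  simp only [add_apply, smul_apply, sum_apply, smul_eq_mul, e1]
  simp only [gp, gx, ContinuousLinearMap.comp_apply, ContinuousLinearMap.proj_apply, ContinuousLinearMap.coe_fst', add_mul,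
    Finset.sum_add_distrib, Finset.sum_sub_distrib, Finset.sum_mul, neg_mul, Finset.sum_neg_distrib]
  have : ∀ i, B i * (2 * z.1 i * w.1 i) = 2 * B i * z.1 i * w.1 i := fun i => by ring
  simp only [this]; ring

lemma fderiv_FB_p {N : ℕ} (a B : Fin N → ℝ) (z : Phase N) (k : Fin N) :
    fderiv ℝ (FBdeg a B) z ((0 : Fin N → ℝ), Pi.single k 1) = gp a B z k := by
  simp [fderiv_FB, Pi.single_apply]
lemma fderiv_FB_x {N : ℕ} (a B : Fin N → ℝ) (z : Phase N) (k : Fin N) :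
    fderiv ℝ (FBdeg a B) z (Pi.single k 1, (0 : Fin N → ℝ)) = gx a B z k := by
  simp [fderiv_FB, Pi.single_apply]

lemma cf_cyc {N : ℕ} (a B B' : Fin N → ℝ) (h : ∀ i j, a i = a j → B i = B j)
    (h' : ∀ i j, a i = a j → B' i = B' j) (i j k : Fin N) :
    (cf a B i k * cf a B' j k - cf a B j k * cf a B' i k)
    + (cf a B j i * cf a B' k i - cf a B k i * cf a B' j i)
    + (cf a B k j * cf a B' i j - cf a B i j * cf a B' k j) = 0 := by
  rw [cf_symm a B j i, cf_symm a B k i, cf_symm a B k j, cf_symm a B' j i, cf_symm a B' k i, cf_symm a B' k j]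
  by_cases e1 : a i = a j
  · simp only [cf, e1, h i j e1, h' i j e1, if_true]; ring
  by_cases e2 : a i = a k
  · simp only [cf, e2, h i k e2, h' i k e2, if_true]
    by_cases e3 : a j = a k
    · simp [e3]
    · have e4 : a j - a k ≠ 0 := sub_ne_zero.2 e3
      have e5 : a k - a j ≠ 0 := sub_ne_zero.2 (Ne.symm e3)
      simp only [if_neg e3, if_neg (Ne.symm e3)]
      field_simp; ring
  by_cases e3 : a j = a k
  · simp only [cf, e3, h j k e3, h' j k e3, if_true]; ring
  simp only [cf, if_neg e1, if_neg e2, if_neg e3]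
  have := sub_ne_zero.2 e1
  have := sub_ne_zero.2 e2
  have := sub_ne_zero.2 e3
  field_simp; ring

lemma sum_cyc {N : ℕ} (f : Fin N → Fin N → Fin N → ℝ) :
    ∑ i, ∑ j, ∑ k, f i j k = ∑ i, ∑ j, ∑ k, f j k i := by
  rw [Finset.sum_comm (f := fun i j => ∑ k, f j k i)]
  refine Finset.sum_congr rfl fun i _ => ?_
  rw [Finset.sum_comm]

lemma pb_FF {N : ℕ} (a B B' : Fin N → ℝ) (h : ∀ i j, a i = a j → B i = B j)
    (h' : ∀ i j, a i = a j → B' i = B' j) (z : Phase N) :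
    pb (FBdeg a B) (FBdeg a B') z = 0 := by
  unfold pb
  simp only [fderiv_FB_p, fderiv_FB_x]
  have e : ∀ k, gp a B z k * gx a B' z k - gx a B z k * gp a B' z k =
     - (∑ i, ∑ j, cf a B i k * cf a B' j k * (Mf i k z * Mf j k z * Mf i j z))
     + ∑ i, 2 * z.1 i * z.1 k * Mf i k z * (cf a B i k * B' k - cf a B' i k * B k) := by
    intro k
    have t1 : (∑ i, ∑ j, cf a B i k * cf a B' j k * (Mf i k z * Mf j k z * Mf i j z))
      = gp a B z k * (∑ j, cf a B' j k * Mf j k z * z.2 j)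
        - (∑ i, cf a B i k * Mf i k z * z.2 i) * gp a B' z k := by
      unfold gp
      simp only [Finset.sum_mul_sum, ← Finset.sum_sub_distrib]
      refine Finset.sum_congr rfl fun i _ => Finset.sum_congr rfl fun j _ => ?_
      have : Mf i j z = z.1 i * z.2 j - z.1 j * z.2 i := rfl
      rw [this]; ring
    have t2 : ∑ i, 2 * z.1 i * z.1 k * Mf i k z * (cf a B i k * B' k - cf a B' i k * B k) =
      gp a B z k * (2 * B' k * z.1 k) - (2 * B k * z.1 k) * gp a B' z k := by
      unfold gp
      simp only [Finset.sum_mul, Finset.mul_sum, ← Finset.sum_sub_distrib]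
      refine Finset.sum_congr rfl fun i _ => ?_
      ring
    rw [t1, t2]; unfold gx; ring
  simp only [e, Finset.sum_add_distrib, Finset.sum_neg_distrib]
  have s2 : ∑ k, ∑ i, 2 * z.1 i * z.1 k * Mf i k z * (cf a B i k * B' k - cf a B' i k * B k) = 0 := by
    set S := ∑ k, ∑ i, 2 * z.1 i * z.1 k * Mf i k z * (cf a B i k * B' k - cf a B' i k * B k) with hS
    have hS' : S = ∑ k, ∑ i, 2 * z.1 k * z.1 i * Mf k i z * (cf a B k i * B' i - cf a B' k i * B i) := by
      rw [hS, Finset.sum_comm]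
    have : S + S = 0 := by
      nth_rewrite 1 [hS]
      rw [hS', ← Finset.sum_add_distrib]
      refine Finset.sum_eq_zero fun k _ => ?_
      rw [← Finset.sum_add_distrib]
      refine Finset.sum_eq_zero fun i _ => ?_
      rw [Mf_symm k i, cf_symm a B k i, cf_symm a B' k i]
      have q1 := cf_mul a B h i k
      have q2 := cf_mul a B' h' i k
      linear_combination 2 * z.1 i * z.1 k * Mf i k z * (cf a B i k * q2 - cf a B' i k * q1)
    linarith
  have s1 : ∑ k, ∑ i, ∑ j, cf a B i k * cf a B' j k * (Mf i k z * Mf j k z * Mf i j z) = 0 := by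
    set S := ∑ k, ∑ i, ∑ j, cf a B i k * cf a B' j k * (Mf i k z * Mf j k z * Mf i j z) with hS
    have hS' : S = ∑ k, ∑ i, ∑ j, cf a B j k * cf a B' i k * (Mf j k z * Mf i k z * Mf j i z) := by
      rw [hS]
      refine Finset.sum_congr rfl fun k _ => ?_
      rw [Finset.sum_comm]
    have h2 : S + S = ∑ k, ∑ i, ∑ j, (cf a B i k * cf a B' j k - cf a B j k * cf a B' i k) * (Mf i k z * Mf j k z * Mf i j z) := by
      nth_rewrite 1 [hS]
      rw [hS', ← Finset.sum_add_distrib]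
      refine Finset.sum_congr rfl fun k _ => ?_
      rw [← Finset.sum_add_distrib]
      refine Finset.sum_congr rfl fun i _ => ?_
      rw [← Finset.sum_add_distrib]
      refine Finset.sum_congr rfl fun j _ => ?_
      rw [Mf_symm j i]; ring
    have h3 := h2
    rw [sum_cyc] at h3
    have h4 := h3
    rw [sum_cyc] at h4
    have : (S + S) + (S + S) + (S + S) = 0 := by
      nth_rewrite 1 [h2]
      nth_rewrite 1 [h3]
      rw [h4, ← Finset.sum_add_distrib, ← Finset.sum_add_distrib]
      refine Finset.sum_eq_zero fun k _ => ?_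
      rw [← Finset.sum_add_distrib, ← Finset.sum_add_distrib]
      refine Finset.sum_eq_zero fun i _ => ?_
      rw [← Finset.sum_add_distrib, ← Finset.sum_add_distrib]
      refine Finset.sum_eq_zero fun j _ => ?_
      have q := cf_cyc a B B' h h' i j k
      rw [Mf_symm j i, Mf_symm k i, Mf_symm k j]
      linear_combination (Mf i k z * Mf j k z * Mf i j z) * q
    linarith
  rw [s1, s2]; simp

lemma pb_anti {N : ℕ} (F G : Phase N → ℝ) (z : Phase N) : pb F G z = - pb G F z := by
  unfold pb
  rw [← Finset.sum_neg_distrib]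
  exact Finset.sum_congr rfl fun k _ => by ring

lemma pb_FM {N : ℕ} (a B : Fin N → ℝ) (p q : Fin N) (ha : a p = a q) (hB : B p = B q)
    (z : Phase N) : pb (FBdeg a B) (Mf p q) z = 0 := by
  unfold pb
  simp only [fderiv_FB_p, fderiv_FB_x, fderiv_M]
  have : ∑ k, (gp a B z k * ((z.1 p * (0 : Fin N → ℝ) q + z.2 q * (Pi.single k (1:ℝ) : Fin N → ℝ) p) -
        (z.1 q * (0 : Fin N → ℝ) p + z.2 p * (Pi.single k (1:ℝ) : Fin N → ℝ) q)) -
      gx a B z k * ((z.1 p * (Pi.single k (1:ℝ) : Fin N → ℝ) q + z.2 q * (0 : Fin N → ℝ) p) -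
        (z.1 q * (Pi.single k (1:ℝ) : Fin N → ℝ) p + z.2 p * (0 : Fin N → ℝ) q)))
      = gp a B z p * z.2 q - gp a B z q * z.2 p - gx a B z q * z.1 p + gx a B z p * z.1 q := by
    simp [Pi.single_apply, mul_sub, Finset.sum_sub_distrib]
    ring
  rw [this]
  unfold gp gx
  have hc : ∀ i, cf a B i p = cf a B i q := fun i => by simp [cf, ha, hB]
  simp only [hc, hB, add_mul, neg_mul, Finset.sum_mul]
  have : ∑ i, cf a B i q * Mf i p z * z.1 i * z.2 q - ∑ i, cf a B i q * Mf i q z * z.1 i * z.2 p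
     + ∑ i, cf a B i q * Mf i q z * z.2 i * z.1 p - ∑ i, cf a B i q * Mf i p z * z.2 i * z.1 q = 0 := by
    rw [← Finset.sum_sub_distrib, ← Finset.sum_add_distrib, ← Finset.sum_sub_distrib]
    refine Finset.sum_eq_zero fun i _ => ?_
    unfold Mf; ring
  linear_combination this

lemma pb_MM {n : ℕ} (i j : Fin ((n+1)/2)) (z : Phase (n+1)) :
    pb (Mf (pIdx n i) (qIdx n i)) (Mf (pIdx n j) (qIdx n j)) z = 0 := by
  by_cases e : i = j
  · subst e
    have := pb_anti (Mf (pIdx n i) (qIdx n i)) (Mf (pIdx n i) (qIdx n i)) z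
    linarith
  have e' : i.val ≠ j.val := fun h => e (Fin.ext h)
  have h1 : pIdx n i ≠ pIdx n j := by simp [pIdx]; omega
  have h2 : pIdx n i ≠ qIdx n j := by simp [pIdx, qIdx]; omega
  have h3 : qIdx n i ≠ pIdx n j := by simp [pIdx, qIdx]; omega
  have h4 : qIdx n i ≠ qIdx n j := by simp [qIdx]; omega
  unfold pb
  simp only [fderiv_M]
  refine Finset.sum_eq_zero fun k _ => ?_
  simp only [Pi.single_apply, Pi.zero_apply]
  by_cases k1 : pIdx n i = k
  · subst k1; simp [h1, h2, Ne.symm h1, Ne.symm h2]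
  by_cases k2 : qIdx n i = k
  · subst k2; simp [h3, h4, Ne.symm h3, Ne.symm h4]
  simp [k1, k2]

lemma finite_bad {V W : Type*} [AddCommGroup V] [Module ℝ V] [FiniteDimensional ℝ V]
    [AddCommGroup W] [Module ℝ W] [FiniteDimensional ℝ W]
    (hd : Module.finrank ℝ V = Module.finrank ℝ W) (A S : V →ₗ[ℝ] W)
    (hS : Function.Injective S) : {t : ℝ | ∃ b : V, b ≠ 0 ∧ A b + t • S b = 0}.Finite := by
  let e := LinearMap.linearEquivOfInjective S hS hd
  let T : Module.End ℝ V := e.symm.toLinearMap ∘ₗ A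
  have hT : {t : ℝ | Module.End.HasEigenvalue T t}.Finite := Module.End.finite_hasEigenvalue T
  refine (hT.image (fun t => -t)).subset ?_
  rintro t ⟨b, hb, h⟩
  refine ⟨-t, ?_, by simp⟩
  refine Module.End.hasEigenvalue_of_hasEigenvector (x := b) ⟨?_, hb⟩
  rw [Module.End.mem_eigenspace_iff]
  change e.symm (A b) = -t • b
  rw [LinearEquiv.symm_apply_eq, map_smul, LinearMap.linearEquivOfInjective_apply, neg_smul]
  exact eq_neg_of_add_eq_zero_left h

lemma cf_add {N : ℕ} (a B B' : Fin N → ℝ) (i j : Fin N) :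
    cf a (B + B') i j = cf a B i j + cf a B' i j := by
  unfold cf; split_ifs
  · simp
  · simp only [Pi.add_apply]; ring

lemma cf_smul {N : ℕ} (a B : Fin N → ℝ) (r : ℝ) (i j : Fin N) :
    cf a (r • B) i j = r * cf a B i j := by
  unfold cf; split_ifs
  · simp
  · simp only [Pi.smul_apply, smul_eq_mul]; ring

/-- gp as a linear map in B -/
noncomputable def gpL {N : ℕ} (a : Fin N → ℝ) (z : Phase N) (k : Fin N) : (Fin N → ℝ) →ₗ[ℝ] ℝ where
  toFun B := gp a B z k
  map_add' B B' := by simp only [gp, cf_add, add_mul, Finset.sum_add_distrib]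
  map_smul' r B := by
    simp only [gp, cf_smul, Finset.mul_sum, smul_eq_mul, RingHom.id_apply, mul_assoc]

lemma gpL_apply {N : ℕ} (a B : Fin N → ℝ) (z : Phase N) (k : Fin N) : gpL a z k B = gp a B z k := rfl

lemma gp_x {N : ℕ} (a B : Fin N → ℝ) (z : Phase N) : ∑ k, gp a B z k * z.1 k = 0 := by
  unfold gp
  simp only [Finset.sum_mul]
  set S := ∑ k, ∑ i, cf a B i k * Mf i k z * z.1 i * z.1 k with hS
  have hS' : S = ∑ k, ∑ i, cf a B k i * Mf k i z * z.1 k * z.1 i := by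
    rw [hS, Finset.sum_comm]
  have : S + S = 0 := by
    nth_rewrite 1 [hS]
    rw [hS', ← Finset.sum_add_distrib]
    refine Finset.sum_eq_zero fun k _ => ?_
    rw [← Finset.sum_add_distrib]
    refine Finset.sum_eq_zero fun i _ => ?_
    rw [Mf_symm k i, cf_symm a B k i]; ring
  linarith

lemma gp_add {N : ℕ} (a B : Fin N → ℝ) (x p q : Fin N → ℝ) (t : ℝ) (k : Fin N) :
    gp a B (x, p + t • q) k = gp a B (x, p) k + t * gp a B (x, q) k := by
  unfold gp
  rw [Finset.mul_sum, ← Finset.sum_add_distrib]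
  refine Finset.sum_congr rfl fun i _ => ?_
  simp only [Mf, Pi.add_apply, Pi.smul_apply, smul_eq_mul]; ring

/-- paired, zero at 0 -/
def VV (n : ℕ) : Submodule ℝ (Fin (n+1) → ℝ) where
  carrier := {B | Paired n B ∧ B 0 = 0}
  add_mem' := by
    rintro B B' ⟨h1, h2⟩ ⟨h3, h4⟩
    exact ⟨fun k l h => by simp [h1 k l h, h3 k l h], by simp [h2, h4]⟩
  zero_mem' := ⟨fun _ _ _ => rfl, rfl⟩
  smul_mem' := by
    rintro c B ⟨h1, h2⟩
    exact ⟨fun k l h => by simp [h1 k l h], by simp [h2]⟩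

/-- bilinear form -/
noncomputable def QQ {n : ℕ} (a : Fin (n+1) → ℝ) (z : Phase (n+1)) : VV n →ₗ[ℝ] Module.Dual ℝ (VV n) :=
  LinearMap.mk₂ ℝ (fun B B' => ∑ k, gpL a z k B.1 * (B'.1 k * z.1 k))
    (fun B C D => by simp [add_mul, Finset.sum_add_distrib])
    (fun r B C => by simp [Finset.mul_sum, mul_assoc])
    (fun B C D => by simp [add_mul, mul_add, Finset.sum_add_distrib])
    (fun r B C => by
      simp only [Finset.mul_sum, smul_eq_mul, Submodule.coe_smul, Pi.smul_apply]
      exact Finset.sum_congr rfl fun k _ => by ring)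

lemma QQ_apply {n : ℕ} (a : Fin (n+1) → ℝ) (z : Phase (n+1)) (B B' : VV n) :
    QQ a z B B' = ∑ k, gp a B.1 z k * (B'.1 k * z.1 k) := rfl

/-- special momentum -/
noncomputable def pst {N : ℕ} (a x : Fin N → ℝ) (k : Fin N) : ℝ := ((∑ i, a i * x i ^ 2) - a k) * x k

lemma QQ_inj {n : ℕ} (a x : Fin (n+1) → ℝ) (ha : ∀ B, Paired n B → ∀ i j, a i = a j → B i = B j)
    (hx : ∀ k, x k ≠ 0) : Function.Injective (QQ a (x, pst a x)) := by
  rw [← LinearMap.ker_eq_bot, LinearMap.ker_eq_bot']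
  rintro ⟨B, hB, hB0⟩ h
  have h := LinearMap.congr_fun h ⟨B, hB, hB0⟩
  rw [QQ_apply] at h
  simp only [LinearMap.zero_apply, gp, Finset.sum_mul] at h
  set S := ∑ k, ∑ i, (B i - B k) * B k * (x i ^ 2 * x k ^ 2) with hS
  have h0 : S = 0 := by
    rw [← h]
    refine Finset.sum_congr rfl fun k _ => Finset.sum_congr rfl fun i _ => ?_
    have q := cf_mul a B (ha B hB) i k
    simp only [Mf, pst]
    linear_combination (- B k * (x i ^ 2 * x k ^ 2)) * q
  have hS' : S = ∑ k, ∑ i, (B k - B i) * B i * (x k ^ 2 * x i ^ 2) := by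
    rw [hS, Finset.sum_comm]
  have h2 : ∑ k, ∑ i, (B i - B k) ^ 2 * (x i ^ 2 * x k ^ 2) = 0 := by
    have : -(S + S) = ∑ k, ∑ i, (B i - B k) ^ 2 * (x i ^ 2 * x k ^ 2) := by
      nth_rewrite 1 [hS]
      rw [hS', ← Finset.sum_add_distrib, ← Finset.sum_neg_distrib]
      refine Finset.sum_congr rfl fun k _ => ?_
      rw [← Finset.sum_add_distrib, ← Finset.sum_neg_distrib]
      refine Finset.sum_congr rfl fun i _ => ?_
      ring
    rw [← this, h0]; simp
  have h3 := (Finset.sum_eq_zero_iff_of_nonneg (fun k _ => Finset.sum_nonneg fun i _ => by positivity)).1 h2 0 (Finset.mem_univ _)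
  have h4 := (Finset.sum_eq_zero_iff_of_nonneg (fun i _ => by positivity)).1 h3
  apply Subtype.ext
  funext i
  have h5 := h4 i (Finset.mem_univ _)
  have := hx i
  have := hx 0
  simpa [hB0, hx] using h5

/-- block indicator -/
def ind (n m : ℕ) (l : Fin (n+1)) : ℝ := if (l : ℕ)/2 = m then 1 else 0

lemma ind_paired (n m : ℕ) : Paired n (ind n m) := by
  intro k l h; simp [ind, h]

/-- the functions -/
noncomputable def GG {n : ℕ} (a : Fin (n+1) → ℝ) (k : Fin n) : Phase (n+1) → ℝ :=
  if (k : ℕ) % 2 = 1 then FBdeg a (ind n ((k+1)/2))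
  else Mf (pIdx n ⟨k/2, by have := k.isLt; omega⟩) (qIdx n ⟨k/2, by have := k.isLt; omega⟩)

lemma indep {n : ℕ} (a : Fin (n+1) → ℝ) (z : Phase (n+1)) (hz : z ∈ TS (n+1))
    (hx : ∀ k, z.1 k ≠ 0) (hQ : ∀ B : VV n, QQ a z B = 0 → B = 0) : IndepAt (GG a) z := by
  intro c hc
  let B : Fin (n+1) → ℝ := ∑ k : Fin n, (if (k : ℕ) % 2 = 1 then c k else 0) • ind n ((k+1)/2)
  have hB : B ∈ VV n := by
    refine Submodule.sum_mem _ fun k _ => ?_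
    by_cases hk : (k : ℕ) % 2 = 1
    · refine Submodule.smul_mem _ _ ⟨ind_paired _ _, ?_⟩
      have : ¬ (0 = ((k:ℕ)+1)/2) := by omega
      simp [ind, this]
    · simp [hk]
  have hB0 : B = 0 := by
    have := hQ ⟨B, hB⟩ ?_
    · exact congrArg Subtype.val this
    ext ⟨B', hB', hB'0⟩
    rw [QQ_apply]
    simp only [LinearMap.zero_apply]
    set s := ∑ k, B' k * z.1 k ^ 2 with hs
    let v : Fin (n+1) → ℝ := fun k => (B' k - s) * z.1 k
    have ht : TangentTS z ((0 : Fin (n+1) → ℝ), v) := by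
      refine ⟨by simp, ?_⟩
      have : ∑ k, z.1 k * v k = s - s * ∑ k, z.1 k ^ 2 := by
        rw [hs, Finset.mul_sum, ← Finset.sum_sub_distrib]
        exact Finset.sum_congr rfl fun k _ => by simp only [v, ← hs]; ring
      simp [this, hz.1]
    have h := hc _ ht
    have e : ∀ k : Fin n, c k * fderiv ℝ (GG a k) z ((0 : Fin (n+1) → ℝ), v) =
        ∑ l, gpL a z l ((if (k : ℕ) % 2 = 1 then c k else 0) • ind n ((k+1)/2)) * v l := by
      intro k
      by_cases hk : (k : ℕ) % 2 = 1
      · simp [GG, hk, fderiv_FB, gpL_apply, Finset.mul_sum, mul_assoc]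
      · simp only [GG, hk, if_false, fderiv_M, zero_smul, map_zero, zero_mul, Finset.sum_const_zero]
        have := hB' (pIdx n ⟨k/2, by have := k.isLt; omega⟩) (qIdx n ⟨k/2, by have := k.isLt; omega⟩)
          (by simp [pIdx, qIdx]; omega)
        simp only [v, this, Pi.zero_apply]; ring
    simp only [e] at h
    rw [Finset.sum_comm] at h
    simp only [← Finset.sum_mul, ← map_sum] at h
    change ∑ l, gp a B z l * v l = 0 at h
    have h2 := gp_x a B z
    have h3 : ∑ l, gp a B z l * v l = ∑ k, gp a B z k * (B' k * z.1 k) - s * ∑ k, gp a B z k * z.1 k := by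
      rw [Finset.mul_sum, ← Finset.sum_sub_distrib]
      exact Finset.sum_congr rfl fun k _ => by simp only [v]; ring
    rw [h, h2] at h3
    linarith
  have hodd : ∀ k : Fin n, (k : ℕ) % 2 = 1 → c k = 0 := by
    intro k hk
    have h := congrFun hB0 ⟨k+1, by omega⟩
    simp only [B, Finset.sum_apply, Pi.smul_apply, smul_eq_mul, Pi.zero_apply] at h
    rw [Finset.sum_eq_single k] at h
    · simpa [ind, hk] using h
    · intro l _ hl
      by_cases hl2 : (l : ℕ) % 2 = 1
      · have : (k : ℕ) ≠ l := fun h => hl (Fin.ext h.symm)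
        have : ¬ (((k:ℕ)+1)/2 = ((l:ℕ)+1)/2) := by omega
        simp [ind, this]
      · simp [hl2]
    · simp
  funext k
  by_cases hk : (k : ℕ) % 2 = 1
  · exact hodd k hk
  set i : Fin ((n+1)/2) := ⟨k/2, by have := k.isLt; omega⟩ with hi
  have hpq : pIdx n i ≠ qIdx n i := by simp [pIdx, qIdx]
  let v : Fin (n+1) → ℝ := Pi.single (qIdx n i) (z.1 (pIdx n i)) - Pi.single (pIdx n i) (z.1 (qIdx n i))
  have ht : TangentTS z ((0 : Fin (n+1) → ℝ), v) := by
    refine ⟨by simp, ?_⟩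
    simp [v, mul_sub, Finset.sum_sub_distrib, Pi.single_apply, mul_comm]
  have h := hc _ ht
  rw [Finset.sum_eq_single k] at h
  · simp only [GG, hk, if_false, fderiv_M, ← hi, v] at h
    simp [Pi.single_apply, hpq, hpq.symm] at h
    rcases h with h | h
    · exact h
    · have := hx (pIdx n i)
      have : 0 < z.1 (pIdx n i) ^ 2 := by positivity
      nlinarith [sq_nonneg (z.1 (qIdx n i))]
  · intro l _ hl
    by_cases hl2 : (l : ℕ) % 2 = 1
    · simp [hodd l hl2]
    · have : (k : ℕ) ≠ l := fun h => hl (Fin.ext h.symm)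
      have h5 : ((l:ℕ)/2) ≠ k/2 := by omega
      have h6 : 2 * ((l:ℕ)/2) + 1 ≠ 2 * ((k:ℕ)/2) := by omega
      have h7 : 2 * ((l:ℕ)/2) ≠ 2 * ((k:ℕ)/2) + 1 := by omega
      simp [GG, hl2, fderiv_M, v, Pi.single_apply, pIdx, qIdx, hi, h5, h6, h7]
  · simp

open Filter Topology in
lemma dense1 {n : ℕ} (z : Phase (n+1)) (hz : z ∈ TS (n+1)) :
    z ∈ closure {z' | z' ∈ TS (n+1) ∧ ∀ k, z'.1 k ≠ 0} := by
  obtain ⟨x, p⟩ := z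
  obtain ⟨h1, h2⟩ := hz
  simp only at h1 h2
  let r : ℝ → ℝ := fun s => Real.sqrt (∑ k, (x k + s)^2)
  let X : ℝ → Fin (n+1) → ℝ := fun s k => (x k + s) / r s
  let P : ℝ → Fin (n+1) → ℝ := fun s k => p k - (∑ j, X s j * p j) * X s k
  have r0 : r 0 = 1 := by simp [r, h1]
  have X0 : X 0 = x := by funext k; simp [X, r0]
  have P0 : P 0 = p := by funext k; simp [P, X0, h2]
  have rc : Continuous r := by fun_prop
  have Xc : ∀ k, ContinuousAt (fun s => X s k) 0 := by
    intro k
    exact ContinuousAt.div (by fun_prop) rc.continuousAt (by simp [r0])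
  have Pc : ∀ k, ContinuousAt (fun s => P s k) 0 := by
    intro k
    refine continuousAt_const.sub (ContinuousAt.mul ?_ (Xc k))
    exact tendsto_finset_sum _ fun j _ => (Xc j).mul continuousAt_const
  have hc : ContinuousAt (fun s => (X s, P s)) 0 :=
    (continuousAt_pi.2 Xc).prodMk (continuousAt_pi.2 Pc)
  have ht : Tendsto (fun s => (X s, P s)) (𝓝[≠] 0) (𝓝 (x, p)) := by
    have := hc.tendsto
    rw [X0, P0] at this
    exact this.mono_left nhdsWithin_le_nhds
  refine mem_closure_of_tendsto ht ?_
  have hr : ∀ᶠ s in 𝓝[≠] (0:ℝ), r s ≠ 0 :=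
    (rc.continuousAt.eventually_ne (by simp [r0])).filter_mono nhdsWithin_le_nhds
  have hne : ∀ᶠ s in 𝓝[≠] (0:ℝ), ∀ k, x k + s ≠ 0 := by
    rw [eventually_all]
    intro k
    by_cases hk : x k = 0
    · filter_upwards [self_mem_nhdsWithin] with s hs
      simpa [hk] using hs
    · have : ContinuousAt (fun s : ℝ => x k + s) 0 := by fun_prop
      exact (this.eventually_ne (by simpa using hk)).filter_mono nhdsWithin_le_nhds
  filter_upwards [hr, hne] with s hs hk
  have hX : ∑ k, X s k ^ 2 = 1 := by
    have : r s ^ 2 = ∑ k, (x k + s)^2 := Real.sq_sqrt (Finset.sum_nonneg fun k _ => sq_nonneg _)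
    simp only [X, div_pow, ← Finset.sum_div, ← this]
    field_simp
  refine ⟨⟨hX, ?_⟩, fun k => div_ne_zero (hk k) hs⟩
  have : ∑ k, X s k * P s k = (∑ k, X s k * p k) - (∑ k, X s k * p k) * ∑ k, X s k ^ 2 := by
    rw [Finset.mul_sum, ← Finset.sum_sub_distrib]
    exact Finset.sum_congr rfl fun k _ => by simp only [P]; ring
  simp [this, hX]

open Filter Topology in
lemma dense2 {n : ℕ} (a : Fin (n+1) → ℝ) (ha : ∀ B, Paired n B → ∀ i j, a i = a j → B i = B j)
    (z : Phase (n+1)) (hz : z ∈ TS (n+1)) (hx : ∀ k, z.1 k ≠ 0) :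
    z ∈ closure {z' | z' ∈ TS (n+1) ∧ IndepAt (GG a) z'} := by
  obtain ⟨x, p⟩ := z
  simp only at hx
  have hfin := finite_bad (Subspace.dual_finrank_eq (K := ℝ) (V := VV n)).symm (QQ a (x, p)) (QQ a (x, pst a x))
    (QQ_inj a x ha hx)
  set S := {t : ℝ | ∃ b : VV n, b ≠ 0 ∧ QQ a (x, p) b + t • QQ a (x, pst a x) b = 0} with hS
  have hc : Continuous (fun t : ℝ => ((x, p + t • pst a x) : Phase (n+1))) := by fun_prop
  have ht : Tendsto (fun t : ℝ => ((x, p + t • pst a x) : Phase (n+1))) (𝓝[≠] 0) (𝓝 (x, p)) := by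
    have := hc.tendsto 0
    simp only [zero_smul, add_zero] at this
    exact this.mono_left nhdsWithin_le_nhds
  refine mem_closure_of_tendsto ht ?_
  have hev : ∀ᶠ t in 𝓝[≠] (0:ℝ), t ∉ S := by
    have h1 : (S \ {0})ᶜ ∈ 𝓝 (0:ℝ) :=
      (hfin.subset Set.diff_subset).isClosed.isOpen_compl.mem_nhds (by simp)
    filter_upwards [mem_nhdsWithin_of_mem_nhds h1, self_mem_nhdsWithin] with t h2 h3 h4
    exact h2 ⟨h4, h3⟩
  filter_upwards [hev] with t h
  have hT : ((x, p + t • pst a x) : Phase (n+1)) ∈ TS (n+1) := by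
    refine ⟨hz.1, ?_⟩
    have h1 := hz.1
    have h2 := hz.2
    simp only at h1 h2
    have : ∑ k, x k * pst a x k = (∑ i, a i * x i ^ 2) * ∑ k, x k ^ 2 - ∑ i, a i * x i ^ 2 := by
      rw [Finset.mul_sum, ← Finset.sum_sub_distrib]
      exact Finset.sum_congr rfl fun k _ => by simp only [pst]; ring
    have h3 : ∑ k, x k * (p + t • pst a x) k = ∑ k, x k * p k + t * ∑ k, x k * pst a x k := by
      rw [Finset.mul_sum, ← Finset.sum_add_distrib]
      exact Finset.sum_congr rfl fun k _ => by simp only [Pi.add_apply, Pi.smul_apply, smul_eq_mul]; ring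
    simp only
    rw [h3, this, h1, h2]; ring
  refine ⟨hT, indep a _ hT hx fun B hB => ?_⟩
  by_contra hne
  refine h ⟨B, hne, ?_⟩
  rw [← hB]
  ext B'
  simp only [LinearMap.add_apply, LinearMap.smul_apply, QQ_apply, smul_eq_mul, gp_add, Finset.mul_sum,
    ← Finset.sum_add_distrib]
  exact Finset.sum_congr rfl fun k _ => by ring

/-- Suppose `a₁ = a₂ < a₃ = a₄ < …` (pairs of equal values, the last
value unpaired when `n` is even; encoded via `k ↦ ⌊k/2⌋` on 0-based indices).  Then the
collection of all `F_B` (with `b_{2i-1} = b_{2i}`) together with the linear functions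
`M_{2i-1,2i}`, `1 ≤ i ≤ ⌊(n+1)/2⌋`, is Poisson commutative on `T*Sⁿ`, and it contains
`n` functionally independent functions; in particular the degenerate Neumann system with
potential `∑ aᵢ (Xⁱ)²` on `Sⁿ` is Liouville integrable. -/
theorem degenerate_neumann_liouville_integrable (n : ℕ) (a : Fin (n+1) → ℝ)
    (heq : ∀ k l : Fin (n+1), (k : ℕ)/2 = (l : ℕ)/2 → a k = a l)
    (hlt : ∀ k l : Fin (n+1), (k : ℕ)/2 < (l : ℕ)/2 → a k < a l) :
    -- the collection is Poisson commutative on `T*Sⁿ`: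
    (∀ B B' : Fin (n+1) → ℝ, Paired n B → Paired n B' →
      ∀ z ∈ TS (n+1), pb (FBdeg a B) (FBdeg a B') z = 0) ∧
    (∀ B : Fin (n+1) → ℝ, Paired n B → ∀ i : Fin ((n+1)/2),
      ∀ z ∈ TS (n+1), pb (FBdeg a B) (Mf (pIdx n i) (qIdx n i)) z = 0) ∧
    (∀ i j : Fin ((n+1)/2),
      ∀ z ∈ TS (n+1), pb (Mf (pIdx n i) (qIdx n i)) (Mf (pIdx n j) (qIdx n j)) z = 0) ∧
    -- it contains `n` functionally independent functions:
    (∃ G : Fin n → (Phase (n+1) → ℝ),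
      (∀ k, (∃ B, Paired n B ∧ G k = FBdeg a B) ∨
            (∃ i : Fin ((n+1)/2), G k = Mf (pIdx n i) (qIdx n i))) ∧
      (∀ k l, ∀ z ∈ TS (n+1), pb (G k) (G l) z = 0) ∧
      (∀ z ∈ TS (n+1), z ∈ closure {z' | z' ∈ TS (n+1) ∧ IndepAt G z'})) := by

  have ha : ∀ B, Paired n B → ∀ i j, a i = a j → B i = B j := by
    intro B hB i j h
    apply hB
    rcases lt_trichotomy ((i:ℕ)/2) ((j:ℕ)/2) with h1 | h1 | h1
    · exact absurd h (hlt i j h1).ne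
    · exact h1
    · exact absurd h (hlt j i h1).ne'
  have hpq : ∀ i : Fin ((n+1)/2), ((pIdx n i : Fin (n+1)) : ℕ)/2 = ((qIdx n i : Fin (n+1)) : ℕ)/2 := by
    intro i; simp only [pIdx, qIdx]; omega
  have hFF : ∀ B B' : Fin (n+1) → ℝ, Paired n B → Paired n B' →
      ∀ z ∈ TS (n+1), pb (FBdeg a B) (FBdeg a B') z = 0 :=
    fun B B' h h' z _ => pb_FF a B B' (ha B h) (ha B' h') z
  have hFM : ∀ B : Fin (n+1) → ℝ, Paired n B → ∀ i : Fin ((n+1)/2),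
      ∀ z ∈ TS (n+1), pb (FBdeg a B) (Mf (pIdx n i) (qIdx n i)) z = 0 :=
    fun B h i z _ => pb_FM a B _ _ (heq _ _ (hpq i)) (h _ _ (hpq i)) z
  have hG : ∀ k, (∃ B, Paired n B ∧ GG a k = FBdeg a B) ∨
            (∃ i : Fin ((n+1)/2), GG a k = Mf (pIdx n i) (qIdx n i)) := by
    intro k
    by_cases hk : (k : ℕ) % 2 = 1
    · exact Or.inl ⟨_, ind_paired _ _, by unfold GG; rw [if_pos hk]⟩
    · exact Or.inr ⟨_, by unfold GG; rw [if_neg hk]⟩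
  refine ⟨hFF, hFM, fun i j z _ => pb_MM i j z, GG a, hG, ?_, ?_⟩
  · intro k l z hz
    rcases hG k with ⟨B, hB, e⟩ | ⟨i, e⟩ <;> rcases hG l with ⟨B', hB', e'⟩ | ⟨j, e'⟩ <;> rw [e, e']
    · exact hFF B B' hB hB' z hz
    · exact hFM B hB j z hz
    · rw [pb_anti, hFM B' hB' i z hz, neg_zero]
    · exact pb_MM i j z
  · intro z hz
    have h := dense1 z hz
    refine closure_minimal ?_ isClosed_closure h
    rintro z' ⟨h1, h2⟩
    exact dense2 a ha z' h1 h2
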